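/- Let σ > 0 and let μ be the Gaussian law N(m, σ²) on ℝ. For every rate R ≥ 0 and every ε > 0 there exist a blocklength n ≥ 1 and a code (f, g) with at most 2^(n(R+ε)) codewords whose expected per-symbol squared-error distortion on n i.i.d. samples from μ is at most σ² · 2^(−2R) + ε. (Achievability part of the rate-distortion theorem for the memoryless Gaussian scalar source.) -/

import Mathlib

open MeasureTheory ProbabilityTheory

/-- Expected per-symbol squared-error distortion of a blocklength-`n` code `(f, g)`
with `M` codewords on a source with i.i.d. components of law `μ`. -/
noncomputable def expectedDistortion (n M : ℕ) (μ : Measure ℝ)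
    (f : (Fin n → ℝ) → Fin M) (g : Fin M → (Fin n → ℝ)) : ℝ :=
  ∫ x, (1 / (n : ℝ)) * ∑ i, (x i - g (f x) i) ^ 2 ∂(Measure.pi fun _ : Fin n => μ)

open scoped ENNReal NNReal

lemma rd_pi_withDensity {α : Type*} [MeasurableSpace α] (n : ℕ) (μ : Measure α)
    [IsProbabilityMeasure μ] (r : α → ℝ≥0∞) (hr : Measurable r)
    [IsProbabilityMeasure (μ.withDensity r)] :
    Measure.pi (fun _ : Fin n => μ.withDensity r)
      = (Measure.pi (fun _ : Fin n => μ)).withDensity (fun ω => ∏ i, r (ω i)) := by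
  refine Measure.pi_eq fun s hs => ?_
  rw [withDensity_apply _ (MeasurableSet.univ_pi hs), ← lintegral_indicator (MeasurableSet.univ_pi hs)]
  have h1 : (Set.univ.pi s).indicator (fun ω : Fin n → α => ∏ i, r (ω i))
      = fun ω => ∏ i, (s i).indicator r (ω i) := by
    ext ω
    by_cases h : ω ∈ Set.univ.pi s
    · rw [Set.indicator_of_mem h]
      refine Finset.prod_congr rfl fun i _ => ?_
      rw [Set.indicator_of_mem (h i (Set.mem_univ i))]
    · rw [Set.indicator_of_notMem h]
      simp only [Set.mem_pi, Set.mem_univ, true_imp_iff, not_forall] at h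
      obtain ⟨i, hi⟩ := h
      exact (Finset.prod_eq_zero (Finset.mem_univ i) (Set.indicator_of_notMem hi _)).symm
  rw [h1]
  have hm : ∀ i, Measurable ((s i).indicator r) := fun i => hr.indicator (hs i)
  rw [lintegral_prod_eq_prod_lintegral_of_indepFun Finset.univ
    (fun i (ω : Fin n → α) => (s i).indicator r (ω i))
    (iIndepFun_pi (fun i => (hm i).aemeasurable)) (fun i => (hm i).comp (measurable_pi_apply i))]
  refine Finset.prod_congr rfl fun i _ => ?_
  rw [withDensity_apply _ (hs i), ← lintegral_indicator (hs i)]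
  exact (measurePreserving_eval (fun _ : Fin n => μ) i).lintegral_comp (hm i)

lemma rd_greedy {α β : Type*} [MeasurableSpace α] [MeasurableSpace β] (μ : Measure α) (ν : Measure β)
    [IsProbabilityMeasure μ] [IsProbabilityMeasure ν] (A : Set (α × β)) (hA : MeasurableSet A)
    (G : Set α) (hG : MeasurableSet G) (q : ℝ≥0∞) (hq : ∀ x ∈ G, q ≤ ν {y | (x, y) ∈ A})
    (c : β) (k : ℕ) :
    ∃ (f : α → Fin (k + 1)) (g : Fin (k + 1) → β), Measurable f ∧
      (∀ x, (x, g (f x)) ∈ A ∨ g (f x) = c) ∧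
      MeasurableSet {x | (x, g (f x)) ∈ A} ∧
      μ (G ∩ {x | (x, g (f x)) ∉ A}) ≤ (1 - q) ^ k := by
  induction k with
  | zero =>
    refine ⟨fun _ => 0, fun _ => c, measurable_const, fun x => Or.inr rfl, ?_, ?_⟩
    · exact (measurable_id.prodMk measurable_const) hA
    · simpa using prob_le_one
  | succ k ih =>
    obtain ⟨f, g, hf, hfc, hfm, hU⟩ := ih
    set U := G ∩ {x | (x, g (f x)) ∉ A} with hUdef
    have hUm : MeasurableSet U := hG.inter hfm.compl
    have hAU : MeasurableSet (A ∩ (Prod.fst ⁻¹' U)) := hA.inter (measurable_fst hUm)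
    have hint : ∫⁻ y, μ ((fun x => (x, y)) ⁻¹' (A ∩ (Prod.fst ⁻¹' U))) ∂ν
        = (μ.prod ν) (A ∩ (Prod.fst ⁻¹' U)) := (Measure.prod_apply_symm hAU).symm
    obtain ⟨y, hy⟩ : ∃ y, ∫⁻ y, μ ((fun x => (x, y)) ⁻¹' (A ∩ (Prod.fst ⁻¹' U))) ∂ν
        ≤ μ ((fun x => (x, y)) ⁻¹' (A ∩ (Prod.fst ⁻¹' U))) := by
      apply exists_lintegral_le
      rw [hint]; exact measure_ne_top _ _
    have hlow : q * μ U ≤ μ ((fun x => (x, y)) ⁻¹' (A ∩ (Prod.fst ⁻¹' U))) := by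
      refine le_trans ?_ hy
      rw [hint, Measure.prod_apply hAU, ← setLIntegral_const]
      rw [← lintegral_indicator hUm]
      refine lintegral_mono fun x => ?_
      by_cases hx : x ∈ U
      · rw [Set.indicator_of_mem hx]
        refine (hq x hx.1).trans (measure_mono fun y hy => ?_)
        exact ⟨hy, hx⟩
      · rw [Set.indicator_of_notMem hx]; exact zero_le
    set By : Set α := (fun x => (x, y)) ⁻¹' A with hBy
    have hBym : MeasurableSet By := (measurable_id.prodMk measurable_const) hA
    classical
    let f' : α → Fin (k + 1 + 1) := fun x =>
      if (x, g (f x)) ∈ A then (f x).castSucc else if x ∈ By then Fin.last (k+1) else (f x).castSucc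
    let g' : Fin (k + 1 + 1) → β := Fin.snoc (α := fun _ => β) g y
    have hg1 : ∀ j : Fin (k+1), g' j.castSucc = g j := fun j => Fin.snoc_castSucc (α := fun _ => β) _ _ _
    have hg2 : g' (Fin.last (k+1)) = y := Fin.snoc_last (α := fun _ => β) _ _
    have hmem : ∀ x, (x, g' (f' x)) ∈ A ↔ ((x, g (f x)) ∈ A ∨ x ∈ By) := by
      intro x
      by_cases h1 : (x, g (f x)) ∈ A
      · simp [f', h1, hg1]
      · by_cases h2 : x ∈ By
        · have : (x, y) ∈ A := h2
          simp [f', h1, h2, hg2, this]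
        · simp [f', h1, h2, hg1]
    have hcs : Measurable (fun x => (f x).castSucc) := (measurable_of_finite _).comp hf
    refine ⟨f', g', ?_, ?_, ?_, ?_⟩
    · exact Measurable.ite hfm hcs (Measurable.ite hBym measurable_const hcs)
    · intro x
      by_cases h1 : (x, g (f x)) ∈ A
      · left; rw [hmem]; exact Or.inl h1
      · by_cases h2 : x ∈ By
        · left; rw [hmem]; exact Or.inr h2
        · right
          have := (hfc x).resolve_left h1
          simp [f', h1, h2, hg1, this]
    · have : {x | (x, g' (f' x)) ∈ A} = {x | (x, g (f x)) ∈ A} ∪ By := by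
        ext x; exact hmem x
      rw [this]; exact hfm.union hBym
    · have hset : G ∩ {x | (x, g' (f' x)) ∉ A} = U \ (By ∩ U) := by
        ext x
        simp only [Set.mem_inter_iff, Set.mem_ofPred_eq, hmem, hUdef, Set.mem_sdiff]
        tauto
      have hlow' : q * μ U ≤ μ (By ∩ U) := hlow
      rw [hset, measure_sdiff Set.inter_subset_right (hBym.inter hUm).nullMeasurableSet
        (measure_ne_top _ _)]
      calc μ U - μ (By ∩ U) ≤ μ U - q * μ U := tsub_le_tsub_left hlow' _
        _ = (1 - q) * μ U := by
          rw [ENNReal.sub_mul (fun _ _ => measure_ne_top _ _), one_mul]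
        _ ≤ (1 - q) * (1 - q) ^ k := by gcongr
        _ = (1 - q) ^ (k + 1) := by rw [pow_succ, mul_comm]

lemma rd_var {α : Type*} [MeasurableSpace α] (n : ℕ) (hn : 1 ≤ n) (J : Measure α)
    [IsProbabilityMeasure J] (Z : α → ℝ) (hZ : MemLp Z 2 J) :
    MemLp (fun ω : Fin n → α => (1 / (n:ℝ)) * ∑ i, Z (ω i)) 2 (Measure.pi fun _ : Fin n => J) ∧
    (∫ ω, (1 / (n:ℝ)) * ∑ i, Z (ω i) ∂(Measure.pi fun _ : Fin n => J)) = ∫ a, Z a ∂J ∧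
    Var[fun ω : Fin n → α => (1 / (n:ℝ)) * ∑ i, Z (ω i); Measure.pi fun _ : Fin n => J]
      = Var[Z; J] / n := by
  have hn' : (n : ℝ) ≠ 0 := by positivity
  have hi : ∀ i : Fin n, MemLp (fun ω : Fin n → α => Z (ω i)) 2 (Measure.pi fun _ : Fin n => J) :=
    fun i => hZ.comp_measurePreserving (measurePreserving_eval (fun _ : Fin n => J) i)
  refine ⟨?_, ?_, ?_⟩
  · exact (memLp_finsetSum _ fun i _ => hi i).const_mul _
  · rw [integral_const_mul, integral_finsetSum _ (fun i _ => (hi i).integrable (by norm_num))]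
    have : ∀ i : Fin n, ∫ ω : Fin n → α, Z (ω i) ∂(Measure.pi fun _ : Fin n => J) = ∫ a, Z a ∂J := by
      intro i
      have h := (measurePreserving_eval (fun _ : Fin n => J) i)
      conv_rhs => rw [← h.map_eq]
      rw [integral_map h.measurable.aemeasurable]
      rw [h.map_eq]; exact hZ.1
    simp only [this]
    simp
    field_simp
  · have h := variance_sum_pi (ι := Fin n) (μ := fun _ => J) (X := fun _ => Z) (fun _ => hZ)
    rw [variance_const_mul]
    have h2 : (∑ i : Fin n, fun ω : Fin n → α => Z (ω i)) = fun ω => ∑ i, Z (ω i) := by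
      ext; simp
    rw [h2] at h
    rw [h]
    simp
    field_simp

noncomputable def rdR (m : ℝ) (s d : ℝ≥0) (p : ℝ × ℝ) : ℝ≥0∞ :=
  ENNReal.ofReal (Real.exp ((1/2) * Real.log (s / d) - (p.1 - p.2)^2 / (2 * d) + (p.1 - m)^2 / (2 * s)))

lemma rdR_meas (m : ℝ) (s d : ℝ≥0) : Measurable (rdR m s d) := by
  unfold rdR; fun_prop

lemma rd_dens (m y : ℝ) (s d : ℝ≥0) (hs : s ≠ 0) (hd : d ≠ 0) :
    (gaussianReal m s).withDensity (fun x => rdR m s d (x, y)) = gaussianReal y d := by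
  have hs' : (0:ℝ) < s := by positivity
  have hd' : (0:ℝ) < d := by positivity
  have hR : Measurable (fun x => rdR m s d (x, y)) := (rdR_meas m s d).comp (by fun_prop)
  rw [gaussianReal_of_var_ne_zero _ hs, gaussianReal_of_var_ne_zero _ hd,
    ← withDensity_mul _ (measurable_gaussianPDF _ _) hR]
  congr 1
  ext x
  simp only [Pi.mul_apply, gaussianPDF, rdR]
  rw [← ENNReal.ofReal_mul (gaussianPDFReal_nonneg _ _ _)]
  congr 1
  simp only [gaussianPDFReal]
  rw [mul_assoc, ← Real.exp_add]
  have e1 : -(x - m)^2 / (2 * (s:ℝ)) + ((1/2) * Real.log (s / d) - (x - y)^2 / (2 * d) + (x - m)^2 / (2 * s))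
    = (1/2) * Real.log (s / d) + -(x-y)^2 / (2 * d) := by ring
  rw [e1, Real.exp_add, ← mul_assoc]
  congr 1
  have e2 : Real.exp ((1/2) * Real.log (s / d)) = √(s / d) := by
    rw [Real.sqrt_eq_rpow, Real.rpow_def_of_pos (by positivity), mul_comm]
  rw [e2, Real.sqrt_div hs'.le, Real.sqrt_mul (show 0 ≤ 2 * Real.pi by positivity) s,
    Real.sqrt_mul (show 0 ≤ 2 * Real.pi by positivity) d]
  have := Real.sqrt_pos.2 hs'
  have := Real.sqrt_pos.2 hd'
  have := Real.sqrt_pos.2 (show 0 < 2 * Real.pi by positivity)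
  field_simp

noncomputable def rdJ (m : ℝ) (s d : ℝ≥0) : Measure (ℝ × ℝ) :=
  ((gaussianReal m s).prod (gaussianReal m (s - d))).withDensity (rdR m s d)

lemma rdJ_eq (m : ℝ) (s d : ℝ≥0) (hs : s ≠ 0) (hd : d ≠ 0) :
    rdJ m s d = ((gaussianReal m (s - d)).prod (gaussianReal 0 d)).map (fun p => (p.1 + p.2, p.1)) := by
  ext S hS
  have hm : Measurable (fun p : ℝ × ℝ => (p.1 + p.2, p.1)) := by fun_prop
  rw [rdJ, withDensity_apply _ hS, ← lintegral_indicator hS,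
    lintegral_prod_symm' _ ((rdR_meas m s d).indicator hS), Measure.map_apply hm hS,
    Measure.prod_apply (hm hS)]
  refine lintegral_congr fun y => ?_
  have hSy : MeasurableSet ((fun x => (x, y)) ⁻¹' S) := (measurable_id.prodMk measurable_const) hS
  have h1 : ∀ x, S.indicator (rdR m s d) (x, y)
    = ((fun x => (x, y)) ⁻¹' S).indicator (fun x => rdR m s d (x, y)) x := fun x => rfl
  simp only [h1]
  rw [lintegral_indicator hSy, ← withDensity_apply _ hSy, rd_dens m y s d hs hd]
  have h2 : gaussianReal y d = (gaussianReal 0 d).map (fun w => y + w) := by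
    rw [gaussianReal_map_const_add]; simp
  rw [h2, Measure.map_apply (by fun_prop) hSy]
  rfl

lemma rdJ_prob (m : ℝ) (s d : ℝ≥0) (hs : s ≠ 0) (hd : d ≠ 0) : IsProbabilityMeasure (rdJ m s d) := by
  rw [rdJ_eq m s d hs hd]
  exact Measure.isProbabilityMeasure_map (by fun_prop)

lemma rdJ_fst (m : ℝ) (s d : ℝ≥0) (hs : s ≠ 0) (hd : d ≠ 0) (hds : d ≤ s) :
    (rdJ m s d).map Prod.fst = gaussianReal m s := by
  rw [rdJ_eq m s d hs hd, Measure.map_map (by fun_prop) (by fun_prop)]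
  have := gaussianReal_conv_gaussianReal (m₁ := m) (m₂ := 0) (v₁ := s - d) (v₂ := d)
  rw [tsub_add_cancel_of_le hds, add_zero] at this
  rw [← this]
  rfl

lemma rdJ_sub (m : ℝ) (s d : ℝ≥0) (hs : s ≠ 0) (hd : d ≠ 0) :
    (rdJ m s d).map (fun p => p.1 - p.2) = gaussianReal 0 d := by
  rw [rdJ_eq m s d hs hd, Measure.map_map (by fun_prop) (by fun_prop)]
  have : ((fun p : ℝ × ℝ => p.1 - p.2) ∘ fun p : ℝ × ℝ => (p.1 + p.2, p.1)) = Prod.snd := by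
    ext p; simp
  rw [this, Measure.map_snd_prod]; simp

lemma rd_sq (m : ℝ) (s : ℝ≥0) : MemLp (fun x => (x - m)^2) 2 (gaussianReal m s) ∧
    ∫ x, (x - m)^2 ∂(gaussianReal m s) = s := by
  constructor
  · have h : MemLp (fun x : ℝ => x - m) 4 (gaussianReal m s) :=
      (memLp_id_gaussianReal' 4 (by simp)).sub (memLp_const m)
    have := h.norm_rpow_div (q := 2)
    refine (MemLp.congr_norm (f := fun x => ‖x - m‖ ^ (2 : ℝ≥0∞).toReal) ?_ ?_ ?_)
    · convert this using 1
      rw [ENNReal.eq_div_iff (by simp) (by simp)]; norm_num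
    · exact Measurable.aestronglyMeasurable (by fun_prop)
    · refine Filter.Eventually.of_forall fun x => ?_
      simp
  · have h := variance_fun_id_gaussianReal (μ := m) (v := s)
    rw [variance_eq_integral (by fun_prop), integral_id_gaussianReal] at h
    exact h

def rdA (n : ℕ) (m : ℝ) (s d : ℝ≥0) (δ : ℝ) : Set ((Fin n → ℝ) × (Fin n → ℝ)) :=
  {p | |(1 / (n:ℝ)) * ∑ i, (p.1 i - p.2 i)^2 - d| ≤ δ ∧ |(1 / (n:ℝ)) * ∑ i, (p.1 i - m)^2 - s| ≤ δ}

lemma rdA_meas (n : ℕ) (m : ℝ) (s d : ℝ≥0) (δ : ℝ) : MeasurableSet (rdA n m s d δ) := by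
  have h1 : Measurable (fun p : (Fin n → ℝ) × (Fin n → ℝ) =>
      |(1 / (n:ℝ)) * ∑ i, (p.1 i - p.2 i)^2 - d|) := by fun_prop
  have h2 : Measurable (fun p : (Fin n → ℝ) × (Fin n → ℝ) =>
      |(1 / (n:ℝ)) * ∑ i, (p.1 i - m)^2 - s|) := by fun_prop
  exact (measurableSet_le h1 measurable_const).inter (measurableSet_le h2 measurable_const)

noncomputable def rdC (m : ℝ) (s d : ℝ≥0) : ℝ :=
  Var[fun x => (x - m)^2; gaussianReal m s] + Var[fun x => (x - 0)^2; gaussianReal 0 d]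

def rdE (n : ℕ) (ω : Fin n → ℝ × ℝ) : (Fin n → ℝ) × (Fin n → ℝ) :=
  (fun i => (ω i).1, fun i => (ω i).2)

lemma rdE_meas (n : ℕ) : Measurable (rdE n) := by unfold rdE; fun_prop

lemma rd_cheb {α : Type*} [MeasurableSpace α] (n : ℕ) (hn : 1 ≤ n) (J : Measure α)
    [IsProbabilityMeasure J] (T : α → ℝ) (hT : Measurable T) (m : ℝ) (s : ℝ≥0)
    (hJ : J.map T = gaussianReal m s) (δ : ℝ) (hδ : 0 < δ) :
    (Measure.pi fun _ : Fin n => J) {ω | δ ≤ |(1 / (n:ℝ)) * ∑ i, (T (ω i) - m)^2 - s|}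
      ≤ ENNReal.ofReal (Var[fun x => (x - m)^2; gaussianReal m s] / (n * δ^2)) := by
  have hmp : MeasurePreserving T J (gaussianReal m s) := ⟨hT, hJ⟩
  have hZ : MemLp (fun a => (T a - m)^2) 2 J := (rd_sq m s).1.comp_measurePreserving hmp
  obtain ⟨h1, h2, h3⟩ := rd_var n hn J _ hZ
  have hmean : ∫ a, (T a - m)^2 ∂J = s := by
    rw [← (rd_sq m s).2, ← hJ, integral_map hT.aemeasurable]
    exact Measurable.aestronglyMeasurable (by fun_prop)
  have hvar : Var[fun a => (T a - m)^2; J] = Var[fun x => (x - m)^2; gaussianReal m s] := by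
    rw [← hJ, variance_map]
    · rfl
    · fun_prop
    · fun_prop
  have := meas_ge_le_variance_div_sq h1 hδ
  rw [h2, h3, hmean, hvar, div_div] at this
  exact this

lemma rd_A_prob (n : ℕ) (hn : 1 ≤ n) (m : ℝ) (s d : ℝ≥0) (hs : s ≠ 0) (hd : d ≠ 0) (hds : d ≤ s)
    (δ : ℝ) (hδ : 0 < δ) :
    (Measure.pi fun _ : Fin n => rdJ m s d) {ω | rdE n ω ∉ rdA n m s d δ}
      ≤ ENNReal.ofReal (rdC m s d / (n * δ^2)) := by
  have := rdJ_prob m s d hs hd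
  have h1 := rd_cheb n hn (rdJ m s d) Prod.fst (by fun_prop) m s (rdJ_fst m s d hs hd hds) δ hδ
  have h2 := rd_cheb n hn (rdJ m s d) (fun p => p.1 - p.2) (by fun_prop) 0 d (rdJ_sub m s d hs hd) δ hδ
  rw [rdC, add_div, ENNReal.ofReal_add (div_nonneg (variance_nonneg _ _) (by positivity))
    (div_nonneg (variance_nonneg _ _) (by positivity))]
  refine le_trans (measure_mono ?_) ((measure_union_le _ _).trans (add_le_add h1 h2))
  intro ω hω
  by_contra hc
  apply hω
  simp only [Set.mem_union, Set.mem_ofPred_eq, not_or, not_le, sub_zero] at hc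
  exact ⟨hc.2.le, hc.1.le⟩

noncomputable def rdK (s d : ℝ≥0) (δ : ℝ) : ℝ := (1/2) * Real.log (s / d) + δ / (2 * d) + δ / (2 * s)

lemma rd_change (n : ℕ) (hn : 1 ≤ n) (m : ℝ) (s d : ℝ≥0) (hs : s ≠ 0) (hd : d ≠ 0)
    (δ : ℝ) (S : Set ((Fin n → ℝ) × (Fin n → ℝ))) (hS : MeasurableSet S)
    (hSA : S ⊆ rdA n m s d δ) :
    (Measure.pi fun _ : Fin n => rdJ m s d) (rdE n ⁻¹' S)
      ≤ ENNReal.ofReal (Real.exp (n * rdK s d δ)) *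
        ((Measure.pi fun _ : Fin n => gaussianReal m s).prod
          (Measure.pi fun _ : Fin n => gaussianReal m (s - d))) S := by
  have hs' : (0:ℝ) < s := by positivity
  have hd' : (0:ℝ) < d := by positivity
  have hn' : (0:ℝ) < n := by positivity
  have hp := rdJ_prob m s d hs hd
  have hmp : MeasurePreserving (rdE n)
      (Measure.pi fun _ : Fin n => (gaussianReal m s).prod (gaussianReal m (s - d)))
      ((Measure.pi fun _ : Fin n => gaussianReal m s).prod
          (Measure.pi fun _ : Fin n => gaussianReal m (s - d))) :=
    measurePreserving_arrowProdEquivProdArrow ℝ ℝ (Fin n) (fun _ => gaussianReal m s)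
      (fun _ => gaussianReal m (s - d))
  have hES : MeasurableSet (rdE n ⁻¹' S) := rdE_meas n hS
  unfold rdJ at hp ⊢
  rw [rd_pi_withDensity n _ _ (rdR_meas m s d), withDensity_apply _ hES, ← hmp.measure_preimage
    hS.nullMeasurableSet, ← setLIntegral_const]
  refine setLIntegral_mono measurable_const fun ω hω => ?_
  obtain ⟨ha, hb⟩ := hSA hω
  simp only [rdR]
  rw [← ENNReal.ofReal_prod_of_nonneg (fun i _ => (Real.exp_pos _).le), ← Real.exp_sum]
  apply ENNReal.ofReal_le_ofReal
  apply Real.exp_le_exp.2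
  rw [Finset.sum_add_distrib, Finset.sum_sub_distrib, ← Finset.sum_div, ← Finset.sum_div]
  simp only [rdE] at ha hb
  set P := ∑ i, ((ω i).1 - (ω i).2)^2
  set Q := ∑ i, ((ω i).1 - m)^2
  have ha' := (abs_le.1 ha).1
  have hb' := (abs_le.1 hb).2
  have hP : n * (d - δ) ≤ P := by
    have : (d:ℝ) - δ ≤ P / n := by rw [div_eq_inv_mul, inv_eq_one_div]; linarith
    rw [le_div_iff₀ hn'] at this; linarith
  have hQ : Q ≤ n * (s + δ) := by
    have : Q / n ≤ s + δ := by rw [div_eq_inv_mul, inv_eq_one_div]; linarith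
    rw [div_le_iff₀ hn'] at this; linarith
  have hP2 : n * (d - δ) / (2 * d) ≤ P / (2 * d) := by gcongr
  have hQ2 : Q / (2 * s) ≤ n * (s + δ) / (2 * s) := by gcongr
  have e1 : n * ((d:ℝ) - δ) / (2 * d) = n / 2 - n * (δ / (2 * d)) := by field_simp
  have e2 : n * ((s:ℝ) + δ) / (2 * s) = n / 2 + n * (δ / (2 * s)) := by field_simp
  rw [e1] at hP2
  rw [e2] at hQ2
  simp only [rdK, Finset.sum_const, Finset.card_univ, Fintype.card_fin, nsmul_eq_mul]
  linarith

lemma rd_bad (n : ℕ) (hn : 1 ≤ n) (m : ℝ) (s d : ℝ≥0) (hs : s ≠ 0) (hd : d ≠ 0) (hds : d ≤ s)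
    (δ : ℝ) (hδ : 0 < δ) (q : ℝ≥0∞) :
    (Measure.pi fun _ : Fin n => gaussianReal m s)
      {x | (Measure.pi fun _ : Fin n => gaussianReal m (s - d)) {y | (x, y) ∈ rdA n m s d δ} < q}
      ≤ ENNReal.ofReal (rdC m s d / (n * δ^2)) + ENNReal.ofReal (Real.exp (n * rdK s d δ)) * q := by
  have hp := rdJ_prob m s d hs hd
  have hA := rdA_meas n m s d δ
  set μn := (Measure.pi fun _ : Fin n => gaussianReal m s) with hμn
  set νn := (Measure.pi fun _ : Fin n => gaussianReal m (s - d))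
  set B := {x | νn {y | (x, y) ∈ rdA n m s d δ} < q} with hB
  have hBm : MeasurableSet B :=
    measurableSet_lt (measurable_measure_prodMk_left hA) measurable_const
  have hmap : (Measure.pi fun _ : Fin n => rdJ m s d).map (fun ω i => (ω i).1) = μn := by
    have : SigmaFinite ((rdJ m s d).map Prod.fst) := by
      rw [rdJ_fst m s d hs hd hds]; infer_instance
    rw [Measure.pi_map_pi (μ := fun _ : Fin n => rdJ m s d) (f := fun _ => Prod.fst)
      (fun i => measurable_fst.aemeasurable), rdJ_fst m s d hs hd hds]
  have hS : MeasurableSet (rdA n m s d δ ∩ Prod.fst ⁻¹' B) := hA.inter (measurable_fst hBm)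
  have h1 := rd_A_prob n hn m s d hs hd hds δ hδ
  have h2 := rd_change n hn m s d hs hd δ _ hS Set.inter_subset_left
  rw [← hmap, Measure.map_apply (by fun_prop) hBm]
  refine le_trans (measure_mono ?_) ((measure_union_le _ _).trans (add_le_add h1 (h2.trans ?_)))
  · intro ω hω
    by_cases h : rdE n ω ∈ rdA n m s d δ
    · right; exact ⟨h, hω⟩
    · left; exact h
  · gcongr
    rw [Measure.prod_apply hS]
    calc _ ≤ ∫⁻ x, q ∂μn := by
          refine lintegral_mono fun x => ?_
          by_cases hx : x ∈ B
          · refine le_trans (measure_mono ?_) (le_of_lt hx)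
            intro y hy; exact hy.1
          · have : Prod.mk x ⁻¹' (rdA n m s d δ ∩ Prod.fst ⁻¹' B) = ∅ := by
              ext y; simp [hx]
            rw [this]; simp
      _ = q := by simp [hμn]

lemma rd_code (n : ℕ) (hn : 1 ≤ n) (m : ℝ) (s d : ℝ≥0) (hs : s ≠ 0) (hd : d ≠ 0) (hds : d ≤ s)
    (δ : ℝ) (hδ : 0 < δ) (q : ℝ) (hq0 : 0 ≤ q) (hq1 : q ≤ 1) (k : ℕ) :
    ∃ (f : (Fin n → ℝ) → Fin (k + 1)) (g : Fin (k + 1) → (Fin n → ℝ)), Measurable f ∧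
      expectedDistortion n (k + 1) (gaussianReal m s) f g ≤
        d + 2 * δ + rdC m s d / (n * δ) +
        s * (rdC m s d / (n * δ^2) + Real.exp (n * rdK s d δ) * q + (1 - q) ^ k) := by
  have hA := rdA_meas n m s d δ
  have hn' : (0:ℝ) < n := by positivity
  set μn := (Measure.pi fun _ : Fin n => gaussianReal m s) with hμn
  set νn := (Measure.pi fun _ : Fin n => gaussianReal m (s - d)) with hνn
  set G := {x | ENNReal.ofReal q ≤ νn {y | (x, y) ∈ rdA n m s d δ}} with hG
  have hGm : MeasurableSet G :=
    measurableSet_le measurable_const (measurable_measure_prodMk_left hA)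
  obtain ⟨f, g, hf, hfc, hfm, hU⟩ := rd_greedy μn νn _ hA G hGm (ENNReal.ofReal q)
    (fun x hx => hx) (fun _ => m) k
  refine ⟨f, g, hf, ?_⟩
  have hbad := rd_bad n hn m s d hs hd hds δ hδ (ENNReal.ofReal q)
  rw [← hμn, ← hνn] at hbad
  set U := {x | (x, g (f x)) ∉ rdA n m s d δ} with hUdef
  have hUm : MeasurableSet U := hfm.compl
  have hC : 0 ≤ rdC m s d := add_nonneg (variance_nonneg _ _) (variance_nonneg _ _)
  have hUle : μn.real U ≤ rdC m s d / (n * δ^2) + Real.exp (n * rdK s d δ) * q + (1 - q) ^ k := by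
    have h1 : (0:ℝ) ≤ rdC m s d / (n * δ^2) := by positivity
    have h2 : (0:ℝ) ≤ (1 - q) ^ k := pow_nonneg (by linarith) _
    have h3 : 0 ≤ Real.exp (n * rdK s d δ) * q := by positivity
    rw [Measure.real]
    apply ENNReal.toReal_le_of_le_ofReal (by positivity)
    rw [ENNReal.ofReal_add (by positivity) h2, ENNReal.ofReal_add h1 h3,
      ENNReal.ofReal_mul (Real.exp_pos _).le, ENNReal.ofReal_pow (by linarith),
      ENNReal.ofReal_sub _ hq0, ENNReal.ofReal_one]
    refine le_trans (measure_mono ?_) ((measure_union_le _ _).trans (add_le_add hbad hU))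
    intro x hx
    by_cases h : x ∈ G
    · right; exact ⟨h, hx⟩
    · left
      have h' : ¬ (ENNReal.ofReal q ≤ νn {y | (x, y) ∈ rdA n m s d δ}) := h
      exact not_le.1 h'
  obtain ⟨h1, h2, h3⟩ := rd_var n hn (gaussianReal m s) _ (rd_sq m s).1
  rw [(rd_sq m s).2] at h2
  rw [variance_eq_integral h1.1.aemeasurable, h2] at h3
  rw [← hμn] at h1 h2 h3
  set T : (Fin n → ℝ) → ℝ := fun x => (1 / (n:ℝ)) * ∑ i, (x i - m)^2 with hT
  have hI : Integrable (fun x => (T x - s)^2) μn := by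
    have : MemLp (fun x => T x - s) 2 μn := h1.sub (memLp_const _)
    exact this.integrable_sq
  have hI2 : Integrable (U.indicator (fun _ => (s:ℝ))) μn :=
    (integrable_const _).indicator hUm
  have hpt : ∀ x, (1 / (n : ℝ)) * ∑ i, (x i - g (f x) i) ^ 2 ≤
      (d + 2 * δ) + (1/δ) * (T x - s)^2 + U.indicator (fun _ => (s:ℝ)) x := by
    intro x
    have hsq : 0 ≤ (1/δ) * (T x - s)^2 := by positivity
    by_cases hx : x ∈ U
    · rw [Set.indicator_of_mem hx]
      have hc := (hfc x).resolve_left hx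
      rw [hc]
      change T x ≤ _
      have : T x - s ≤ δ + (1/δ) * (T x - s)^2 := by
        rw [← sub_nonneg]
        have : δ + (1/δ) * (T x - s)^2 - (T x - s) = (1/δ) * ((T x - s - δ/2)^2 + 3/4 * δ^2) := by
          field_simp; ring
        rw [this]; positivity
      have : (0:ℝ) ≤ d := d.2
      linarith
    · rw [Set.indicator_of_notMem hx]
      have hx' : (x, g (f x)) ∈ rdA n m s d δ := not_not.1 hx
      have := (abs_le.1 hx'.1).2
      simp only at this
      linarith
  have hI3 : Integrable (fun x => (d + 2 * δ) + (1/δ) * (T x - s)^2) μn :=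
    (integrable_const _).add (hI.const_mul _)
  unfold expectedDistortion
  calc _ ≤ ∫ x, ((d + 2 * δ) + (1/δ) * (T x - s)^2 + U.indicator (fun _ => (s:ℝ)) x) ∂μn := by
        refine integral_mono_of_nonneg ?_ ?_ ?_
        · exact Filter.Eventually.of_forall fun x => by
            simp only [Pi.zero_apply]; positivity
        · exact hI3.add hI2
        · exact Filter.Eventually.of_forall hpt
    _ = (d + 2 * δ) + (1/δ) * (Var[fun x => (x - m)^2; gaussianReal m s] / n) + s * μn.real U := by
        rw [integral_add hI3 hI2, integral_add (integrable_const _) (hI.const_mul _),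
          integral_const_mul, h3, integral_indicator hUm]
        simp [mul_comm]
    _ ≤ _ := by
        have hv : Var[fun x => (x - m)^2; gaussianReal m s] ≤ rdC m s d :=
          le_add_of_nonneg_right (variance_nonneg _ _)
        have : (1/δ) * (Var[fun x => (x - m)^2; gaussianReal m s] / n) ≤ rdC m s d / (n * δ) := by
          rw [one_div, ← div_eq_inv_mul, div_div]
          gcongr
        gcongr

/-- Achievability part of the rate-distortion theorem for the memoryless Gaussian
scalar source: for every `R ≥ 0` and `ε > 0` there is a blocklength-`n` code with
at most `2 ^ (n * (R + ε))` codewords whose expected per-symbol squared-error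
distortion is at most `σ² * 2 ^ (-2R) + ε`. -/
theorem gaussian_rate_distortion_achievability
    (m σ : ℝ) (hσ : 0 < σ)
    (μ : Measure ℝ) (hμ : μ = gaussianReal m (Real.toNNReal (σ ^ 2)))
    (R : ℝ) (hR : 0 ≤ R) (ε : ℝ) (hε : 0 < ε) :
    ∃ (n M : ℕ) (f : (Fin n → ℝ) → Fin M) (g : Fin M → (Fin n → ℝ)),
      1 ≤ n ∧ Measurable f ∧ (M : ℝ) ≤ 2 ^ ((n : ℝ) * (R + ε)) ∧
      expectedDistortion n M μ f g ≤ σ ^ 2 * 2 ^ (-(2 * R)) + ε := by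
  have h2R : (0:ℝ) < 2 ^ (-(2 * R)) := by positivity
  have h2R1 : (2:ℝ) ^ (-(2 * R)) ≤ 1 := Real.rpow_le_one_of_one_le_of_nonpos (by norm_num) (by linarith)
  set s := Real.toNNReal (σ ^ 2) with hsdef
  set d := Real.toNNReal (σ ^ 2 * 2 ^ (-(2 * R))) with hddef
  have hsv : (s:ℝ) = σ ^ 2 := Real.coe_toNNReal _ (by positivity)
  have hdv : (d:ℝ) = σ ^ 2 * 2 ^ (-(2 * R)) := Real.coe_toNNReal _ (by positivity)
  have hs : s ≠ 0 := by
    intro h; rw [h] at hsv; have : 0 < σ^2 := by positivity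
    simp at hsv; linarith
  have hd : d ≠ 0 := by
    intro h; rw [h] at hdv; have : 0 < σ^2 * 2 ^ (-(2 * R)) := by positivity
    rw [← hdv] at this; simp at this
  have hds : d ≤ s := by
    rw [← NNReal.coe_le_coe, hsv, hdv]
    exact mul_le_of_le_one_right (by positivity) h2R1
  have hs' : (0:ℝ) < s := by positivity
  have hd' : (0:ℝ) < d := by positivity
  have hlog2 : 0 < Real.log 2 := Real.log_pos (by norm_num)
  have hlog : (1/2) * Real.log ((s:ℝ) / d) = R * Real.log 2 := by
    have : (s:ℝ) / d = 2 ^ (2 * R) := by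
      rw [hsv, hdv, Real.rpow_neg (by norm_num)]
      field_simp
    rw [this, Real.log_rpow (by norm_num)]; ring
  -- choose the slack
  set c : ℝ := 1 / (2 * d) + 1 / (2 * s) + 1 with hc
  have hcpos : 0 < c := by positivity
  obtain ⟨δ, hδ, hδ1, hδ2⟩ : ∃ δ : ℝ, 0 < δ ∧ 2 * δ ≤ ε / 2 ∧ c * δ ≤ ε / 2 * Real.log 2 := by
    refine ⟨min (ε / 4) (ε / 2 * Real.log 2 / c), by positivity, ?_, ?_⟩
    · linarith [min_le_left (ε / 4) (ε / 2 * Real.log 2 / c)]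
    · calc c * _ ≤ c * (ε / 2 * Real.log 2 / c) := by gcongr; exact min_le_right _ _
        _ = _ := by field_simp
  have hKδ : rdK s d δ + δ ≤ (R + ε / 2) * Real.log 2 := by
    have : rdK s d δ + δ = R * Real.log 2 + c * δ := by
      rw [rdK, hlog, hc]; ring
    rw [this]; linarith
  have hKnn : 0 ≤ rdK s d δ := by
    rw [rdK, hlog]; positivity
  set C := rdC m s d with hCdef
  -- asymptotics
  have t1 : Filter.Tendsto (fun n : ℕ => C / (n * δ)) Filter.atTop (nhds 0) :=
    Filter.Tendsto.const_div_atTop (tendsto_natCast_atTop_atTop.atTop_mul_const hδ) _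
  have t2 : Filter.Tendsto (fun n : ℕ => C / (n * δ^2)) Filter.atTop (nhds 0) :=
    Filter.Tendsto.const_div_atTop (tendsto_natCast_atTop_atTop.atTop_mul_const (by positivity)) _
  have t3 : Filter.Tendsto (fun n : ℕ => Real.exp (-(n * δ))) Filter.atTop (nhds 0) :=
    Real.tendsto_exp_neg_atTop_nhds_zero.comp (tendsto_natCast_atTop_atTop.atTop_mul_const hδ)
  have t4 : Filter.Tendsto (fun n : ℕ => Real.exp (-(Real.exp (n * (ε / 2 * Real.log 2)) - 2)))
      Filter.atTop (nhds 0) := by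
    refine Real.tendsto_exp_neg_atTop_nhds_zero.comp ?_
    refine Filter.tendsto_atTop_add_const_right _ _ ?_
    exact Real.tendsto_exp_atTop.comp (tendsto_natCast_atTop_atTop.atTop_mul_const (by positivity))
  have t5 : Filter.Tendsto (fun n : ℕ => C / (n * δ) + s * (C / (n * δ^2) + Real.exp (-(n * δ))
      + Real.exp (-(Real.exp (n * (ε / 2 * Real.log 2)) - 2)))) Filter.atTop (nhds 0) := by
    have := t1.add (((t2.add t3).add t4).const_mul (s:ℝ))
    simpa using this
  obtain ⟨n, hn5, hn⟩ := ((t5.eventually (gt_mem_nhds (show (0:ℝ) < ε / 2 by positivity))).and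
    (Filter.eventually_ge_atTop 1)).exists
  have hn0 : (0:ℝ) < n := by positivity
  set X : ℝ := 2 ^ ((n : ℝ) * (R + ε)) with hX
  have hXe : X = Real.exp (n * ((R + ε) * Real.log 2)) := by
    rw [hX, Real.rpow_def_of_pos (by norm_num)]; ring_nf
  have hX1 : 1 ≤ X := Real.one_le_rpow (by norm_num) (by positivity)
  have hfl : 1 ≤ ⌊X⌋₊ := by rw [Nat.one_le_floor_iff]; exact hX1
  obtain ⟨k, hk⟩ : ∃ k, ⌊X⌋₊ = k + 1 := ⟨⌊X⌋₊ - 1, by omega⟩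
  have hkX : ((k + 1 : ℕ) : ℝ) ≤ X := by rw [← hk]; exact Nat.floor_le (by linarith)
  have hkX2 : X - 2 ≤ k := by
    have := Nat.lt_floor_add_one X
    rw [hk] at this; push_cast at this; linarith
  set q := Real.exp (-(n * (rdK s d δ + δ))) with hq
  have hq1 : q ≤ 1 := Real.exp_le_one_iff.2 (by
    have : 0 ≤ n * (rdK s d δ + δ) := by positivity
    linarith)
  obtain ⟨f, g, hf, hfg⟩ := rd_code n hn m s d hs hd hds δ hδ q (Real.exp_pos _).le hq1 k
  refine ⟨n, k + 1, f, g, hn, hf, hkX, ?_⟩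
  rw [hμ]
  refine hfg.trans ?_
  have e1 : Real.exp (n * rdK s d δ) * q = Real.exp (-(n * δ)) := by
    rw [hq, ← Real.exp_add]; ring_nf
  have hqk : Real.exp (n * (ε / 2 * Real.log 2)) - 2 ≤ q * k := by
    have hqX : Real.exp (n * (ε / 2 * Real.log 2)) ≤ q * X := by
      rw [hq, hXe, ← Real.exp_add]
      apply Real.exp_le_exp.2
      have := mul_le_mul_of_nonneg_left hKδ hn0.le
      linarith
    have : q * (X - 2) ≤ q * k := mul_le_mul_of_nonneg_left hkX2 (Real.exp_pos _).le
    linarith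
  have e2 : (1 - q) ^ k ≤ Real.exp (-(Real.exp (n * (ε / 2 * Real.log 2)) - 2)) := by
    calc (1 - q) ^ k ≤ (Real.exp (-q)) ^ k := by
          apply pow_le_pow_left₀ (by linarith)
          linarith [Real.add_one_le_exp (-q)]
      _ = Real.exp (-(q * k)) := by rw [← Real.exp_nat_mul]; ring_nf
      _ ≤ _ := Real.exp_le_exp.2 (by linarith)
  rw [e1]
  have e3 : (s:ℝ) * (C / (n * δ^2) + Real.exp (-(n * δ)) + (1 - q) ^ k) ≤
      s * (C / (n * δ^2) + Real.exp (-(n * δ))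
      + Real.exp (-(Real.exp (n * (ε / 2 * Real.log 2)) - 2))) := by gcongr
  rw [← hdv]
  linarith
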